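/- arXiv:math/0603007 — 2 statements merged into one kernel-verified Lean document; each statement's English description precedes it below -/
import Mathlib

section
/- (Stirling's series) For every natural number N ≥ 0, ln Γ(x) − P(x) − R_N(x) = O(x^{-(2N+1)}) as x → ∞ along the positive reals; in particular ln Γ(x) − P(x) − R_N(x) → 0 as x → ∞. -/
open Filter Asymptotics Topology Real

/-- `P x = x ln x − x − (1/2) ln x + (1/2) ln (2π)`, the leading terms of Stirling. -/
noncomputable def stirlingP (x : ℝ) : ℝ :=
  x * Real.log x - x - (1 / 2) * Real.log x + (1 / 2) * Real.log (2 * π)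

/-- `R_N x = Σ_{k=1}^N B_{2k} / (2k (2k−1) x^(2k−1))`, with `B_j` the Bernoulli numbers. -/
noncomputable def stirlingR (N : ℕ) (x : ℝ) : ℝ :=
  ∑ k ∈ Finset.Icc 1 N,
    ((bernoulli (2 * k) : ℚ) : ℝ) / (2 * k * (2 * k - 1) * x ^ (2 * k - 1))

/-- The Euler–Maclaurin remainder `∫₀¹ B_k(t) (x + t)^{-k} dt` on a unit interval. -/
noncomputable def bernoulliIntegral (k : ℕ) (x : ℝ) : ℝ :=
  ∫ t in (0 : ℝ)..1, bernoulliFun k t / (x + t) ^ k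

lemma intervalIntegrable_bernoulliFun_div_pow (j k : ℕ) {x : ℝ} (hx : 0 < x) :
    IntervalIntegrable (fun t => bernoulliFun j t / (x + t) ^ k) MeasureTheory.volume 0 1 := by
  apply ContinuousOn.intervalIntegrable
  refine (continuous_bernoulliFun j).continuousOn.div (by fun_prop) fun t ht => ?_
  rw [Set.uIcc_of_le zero_le_one] at ht
  have : 0 < x + t := by linarith [ht.1]
  positivity

lemma bernoulliIntegral_one {x : ℝ} (hx : 0 < x) :
    bernoulliIntegral 1 x = 1 - (x + 1 / 2) * (Real.log (x + 1) - Real.log x) := by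
  have hderiv : ∀ t ∈ Set.uIcc (0 : ℝ) 1,
      HasDerivAt (fun t => t - (x + 1 / 2) * Real.log (x + t))
        (bernoulliFun 1 t / (x + t) ^ 1) t := by
    intro t ht
    rw [Set.uIcc_of_le zero_le_one] at ht
    have hxt : x + t ≠ 0 := by linarith [ht.1]
    have hlog := (((hasDerivAt_id t).const_add x).log hxt).const_mul (x + 1 / 2)
    refine ((hasDerivAt_id t).sub hlog).congr_deriv ?_
    simp only [bernoulliFun_one, id]
    field_simp
    ring
  rw [bernoulliIntegral, intervalIntegral.integral_eq_sub_of_hasDerivAt hderiv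
    (intervalIntegrable_bernoulliFun_div_pow 1 1 hx)]
  simp only [add_zero]
  ring

/-- Integration by parts for the Euler–Maclaurin remainder. -/
lemma bernoulliIntegral_div_eq {k : ℕ} (hk : k ≠ 0) {x : ℝ} (hx : 0 < x) :
    bernoulliIntegral k x / k =
      (bernoulli (k + 1) : ℝ) / ((k + 1) * k) * (1 / (x + 1) ^ k - 1 / x ^ k) +
        bernoulliIntegral (k + 1) x / (k + 1) := by
  have hk0 : (k : ℝ) ≠ 0 := by exact_mod_cast hk
  have hk1 : (k : ℝ) + 1 ≠ 0 := by positivity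
  have hderiv : ∀ t ∈ Set.uIcc (0 : ℝ) 1,
      HasDerivAt (fun t => bernoulliFun (k + 1) t / (x + t) ^ k)
        ((k + 1) * (bernoulliFun k t / (x + t) ^ k) -
          k * (bernoulliFun (k + 1) t / (x + t) ^ (k + 1))) t := by
    intro t ht
    rw [Set.uIcc_of_le zero_le_one] at ht
    have hxt : x + t ≠ 0 := by linarith [ht.1]
    have hpow := ((hasDerivAt_id t).const_add x).pow k
    refine ((hasDerivAt_bernoulliFun (k + 1) t).div hpow (pow_ne_zero k hxt)).congr_deriv ?_
    obtain ⟨j, rfl⟩ := Nat.exists_eq_succ_of_ne_zero hk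
    simp only [id, Nat.succ_eq_add_one, Nat.add_sub_cancel, Pi.pow_apply]
    push_cast
    field_simp
    ring
  have hint := (intervalIntegrable_bernoulliFun_div_pow k k hx).const_mul ((k : ℝ) + 1)
  have hint' := (intervalIntegrable_bernoulliFun_div_pow (k + 1) (k + 1) hx).const_mul (k : ℝ)
  have h := intervalIntegral.integral_eq_sub_of_hasDerivAt hderiv (hint.sub hint')
  rw [intervalIntegral.integral_sub hint hint', intervalIntegral.integral_const_mul,
    intervalIntegral.integral_const_mul, bernoulliFun_endpoints_eq_of_ne_one (by omega),
    bernoulliFun_eval_zero, add_zero] at h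
  simp only [bernoulliIntegral]
  generalize (∫ t in (0 : ℝ)..1, bernoulliFun k t / (x + t) ^ k) = I at h ⊢
  generalize (∫ t in (0 : ℝ)..1, bernoulliFun (k + 1) t / (x + t) ^ (k + 1)) = J at h ⊢
  have hx1 : (x + 1) ≠ 0 := by positivity
  field_simp at h ⊢
  linear_combination h

lemma exists_abs_bernoulliIntegral_le (k : ℕ) :
    ∃ C, ∀ x : ℝ, 0 < x → |bernoulliIntegral k x| ≤ C / x ^ k := by
  obtain ⟨C, hC⟩ := (isCompact_Icc (a := (0 : ℝ)) (b := 1)).exists_bound_of_continuousOn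
    (continuous_bernoulliFun k).continuousOn
  refine ⟨C, fun x hx => ?_⟩
  have h : ∀ t ∈ Set.uIoc (0 : ℝ) 1, ‖bernoulliFun k t / (x + t) ^ k‖ ≤ C / x ^ k := by
    intro t ht
    rw [Set.uIoc_of_le zero_le_one] at ht
    have hxt : 0 < x + t := by linarith [ht.1]
    have hB := hC t ⟨ht.1.le, ht.2⟩
    rw [norm_div, norm_pow, Real.norm_of_nonneg hxt.le]
    have hC0 : 0 ≤ C := (norm_nonneg _).trans hB
    gcongr
    linarith [ht.1]
  simpa [bernoulliIntegral] using intervalIntegral.norm_integral_le_of_norm_le_const h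

lemma stirlingR_succ (N : ℕ) (x : ℝ) :
    stirlingR (N + 1) x = stirlingR N x +
      (bernoulli (2 * N + 2) : ℝ) / ((2 * N + 2) * (2 * N + 1)) * (1 / x ^ (2 * N + 1)) := by
  rw [stirlingR, Finset.sum_Icc_succ_top (by omega), stirlingR,
    show 2 * (N + 1) - 1 = 2 * N + 1 by omega, show 2 * (N + 1) = 2 * N + 2 by ring]
  push_cast
  rw [mul_one_div, div_div]
  ring

/-- The remainder of Stirling's series truncated after `N` terms. -/
noncomputable def stirlingRemainder (N : ℕ) (x : ℝ) : ℝ :=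
  Real.log (Real.Gamma x) - stirlingP x - stirlingR N x

lemma log_Gamma_add_one {x : ℝ} (hx : 0 < x) :
    Real.log (Real.Gamma (x + 1)) = Real.log (Real.Gamma x) + Real.log x := by
  rw [Real.Gamma_add_one hx.ne', Real.log_mul hx.ne' (Real.Gamma_pos_of_pos hx).ne', add_comm]

lemma stirlingRemainder_sub_add_one (N : ℕ) {x : ℝ} (hx : 0 < x) :
    stirlingRemainder N x - stirlingRemainder N (x + 1) =
      -(bernoulliIntegral (2 * N + 1) x / (2 * N + 1)) := by
  induction N with
  | zero =>
    simp only [stirlingRemainder, stirlingP, stirlingR, log_Gamma_add_one hx]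
    norm_num [bernoulliIntegral_one hx]
    ring
  | succ N ih =>
    have h₁ := bernoulliIntegral_div_eq (k := 2 * N + 1) (by omega) hx
    have h₂ := bernoulliIntegral_div_eq (k := 2 * N + 2) (by omega) hx
    have hodd : bernoulli (2 * N + 2 + 1) = 0 :=
      bernoulli_eq_zero_of_odd ⟨N + 1, by ring⟩ (by omega)
    rw [hodd] at h₂
    simp only [stirlingRemainder, stirlingR_succ] at ih ⊢
    rw [show 2 * (N + 1) + 1 = 2 * N + 2 + 1 by ring]
    push_cast at h₁ h₂ ⊢
    rw [show 2 * ((N : ℝ) + 1) + 1 = 2 * N + 2 + 1 by ring]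
    rw [show 2 * (N : ℝ) + 1 + 1 = 2 * N + 2 by ring, show 2 * N + 1 + 1 = 2 * N + 2 by ring] at h₁
    linear_combination ih - h₁ - h₂

lemma one_div_pow_succ_le_two_mul_sub {m : ℕ} (hm : m ≠ 0) {y : ℝ} (hy : 1 ≤ y) :
    1 / y ^ (m + 1) ≤ 2 * (1 / y ^ m - 1 / (y + 1) ^ m) := by
  have hy0 : 0 < y := by linarith
  have hq : (y / (y + 1)) ^ m ≤ y / (y + 1) :=
    pow_le_of_le_one (by positivity) ((div_le_one (by positivity)).2 (by linarith)) hm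
  have hsplit : 1 / y ^ m - 1 / (y + 1) ^ m = 1 / y ^ m * (1 - (y / (y + 1)) ^ m) := by
    rw [div_pow]
    field_simp
  have hy2 : 1 / y ≤ 2 * (1 - y / (y + 1)) := by
    rw [show 2 * (1 - y / (y + 1)) = 2 / (y + 1) by field_simp; ring,
      div_le_div_iff₀ hy0 (by positivity)]
    linarith
  calc 1 / y ^ (m + 1) = 1 / y ^ m * (1 / y) := by rw [pow_succ]; field_simp
    _ ≤ 1 / y ^ m * (2 * (1 - (y / (y + 1)) ^ m)) := by gcongr; linarith
    _ = _ := by rw [hsplit]; ring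

/-- A function vanishing along integer translates whose unit differences are `O(x^{-(m+1)})` is
itself `O(x^{-m})`. -/
lemma abs_le_of_abs_sub_add_one_le {g : ℝ → ℝ} {C : ℝ} {m : ℕ} (hm : m ≠ 0)
    (hg : ∀ x, 1 ≤ x → |g x - g (x + 1)| ≤ C / x ^ (m + 1))
    (hlim : ∀ x, 1 ≤ x → Tendsto (fun n : ℕ => g (x + n)) atTop (𝓝 0)) {x : ℝ} (hx : 1 ≤ x) :
    |g x| ≤ 2 * C * (1 / x ^ m) := by
  have hC : 0 ≤ C := by simpa using (abs_nonneg _).trans (hg 1 le_rfl)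
  have hstep (n : ℕ) : |g x - g (x + n)| ≤ 2 * C * (1 / x ^ m - 1 / (x + n) ^ m) := by
    induction n with
    | zero => simp
    | succ n ih =>
      have hxn : 1 ≤ x + n := by linarith [(Nat.cast_nonneg n : (0 : ℝ) ≤ n)]
      have h := (hg _ hxn).trans_eq (div_eq_mul_one_div _ _)
      have h' := mul_le_mul_of_nonneg_left (one_div_pow_succ_le_two_mul_sub hm hxn) hC
      have htri := abs_sub_le (g x) (g (x + n)) (g (x + n + 1))
      push_cast
      rw [← add_assoc]
      linarith
  have hle (n : ℕ) : |g x - g (x + n)| ≤ 2 * C * (1 / x ^ m) := by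
    refine (hstep n).trans (mul_le_mul_of_nonneg_left ?_ (by positivity))
    have : 0 ≤ 1 / (x + n) ^ m := by positivity
    linarith
  have htend := ((hlim x hx).const_sub (g x)).abs
  rw [sub_zero] at htend
  exact le_of_tendsto' htend hle

lemma tendsto_one_div_pow_atTop {m : ℕ} (hm : m ≠ 0) :
    Tendsto (fun x : ℝ => 1 / x ^ m) atTop (𝓝 0) := by
  simpa only [one_div, Function.comp_def] using
    tendsto_inv_atTop_zero.comp (tendsto_pow_atTop (α := ℝ) hm)

lemma tendsto_stirlingR (N : ℕ) : Tendsto (stirlingR N) atTop (𝓝 0) := by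
  induction N with
  | zero => exact tendsto_const_nhds.congr fun x => by simp [stirlingR]
  | succ N ih =>
    have h := ih.add ((tendsto_one_div_pow_atTop (m := 2 * N + 1) (by omega)).const_mul
      ((bernoulli (2 * N + 2) : ℝ) / ((2 * N + 2) * (2 * N + 1))))
    rw [mul_zero, add_zero] at h
    exact h.congr fun x => (stirlingR_succ N x).symm

lemma tendsto_log_Gamma_sub_stirlingP_nat {x : ℝ} (hx : 0 < x) :
    Tendsto (fun n : ℕ => Real.log (Real.Gamma (x + n)) - stirlingP (x + n)) atTop (𝓝 0) := by
  rw [← tendsto_add_atTop_iff_nat 1]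
  have hΓ := (Real.BohrMollerup.tendsto_log_gamma hx).const_sub (Real.log (Real.Gamma x))
  have hseq := Stirling.tendsto_stirlingSeq_sqrt_pi.log (Real.sqrt_pos.2 Real.pi_pos).ne'
  have hmul := (Real.tendsto_mul_log_one_add_div_atTop (x + 1)).comp tendsto_natCast_atTop_atTop
  have hlog : Tendsto (fun n : ℕ => Real.log (1 + (x + 1) / n)) atTop (𝓝 0) := by
    have h := (tendsto_const_div_atTop_nhds_zero_nat (x + 1)).const_add 1
    rw [add_zero] at h
    simpa using h.log one_ne_zero
  have h := ((hΓ.add hseq).sub (hmul.add (hlog.const_mul (x + 1 / 2)))).add_const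
    (x + 1 - 1 / 2 * Real.log π)
  rw [Real.log_sqrt Real.pi_pos.le] at h
  have hzero : Real.log (Real.Gamma x) - Real.log (Real.Gamma x) + Real.log π / 2 -
      (x + 1 + (x + 1 / 2) * 0) + (x + 1 - 1 / 2 * Real.log π) = 0 := by ring
  rw [hzero] at h
  refine h.congr' ?_
  filter_upwards [eventually_gt_atTop 0] with n hn
  have hn0 : (0 : ℝ) < n := by exact_mod_cast hn
  have hsum := Real.BohrMollerup.f_add_nat_eq (f := fun y => Real.log (Real.Gamma y))
    (fun hy => log_Gamma_add_one hy) hx (n + 1)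
  have hquot : Real.log (1 + (x + 1) / n) = Real.log (x + (n + 1)) - Real.log n := by
    rw [← Real.log_div (by positivity) hn0.ne']
    congr 1
    field_simp
    ring
  simp only [Function.comp, Real.BohrMollerup.logGammaSeq, Stirling.log_stirlingSeq_formula,
    hquot, hsum, stirlingP]
  rw [Real.log_mul two_ne_zero hn0.ne', Real.log_div hn0.ne' (Real.exp_ne_zero 1), Real.log_exp,
    Real.log_mul two_ne_zero Real.pi_ne_zero]
  push_cast
  ring

lemma tendsto_stirlingRemainder_nat (N : ℕ) {x : ℝ} (hx : 0 < x) :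
    Tendsto (fun n : ℕ => stirlingRemainder N (x + n)) atTop (𝓝 0) := by
  have hR := (tendsto_stirlingR N).comp
    (tendsto_atTop_add_const_left atTop x tendsto_natCast_atTop_atTop)
  simpa [stirlingRemainder] using (tendsto_log_Gamma_sub_stirlingP_nat hx).sub hR

lemma exists_abs_stirlingRemainder_succ_le (N : ℕ) :
    ∃ C, ∀ x : ℝ, 1 ≤ x → |stirlingRemainder (N + 1) x| ≤ C * (1 / x ^ (2 * N + 2)) := by
  obtain ⟨C, hC⟩ := exists_abs_bernoulliIntegral_le (2 * (N + 1) + 1)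
  refine ⟨2 * C, fun x hx => abs_le_of_abs_sub_add_one_le (by omega) (fun y hy => ?_)
    (fun y hy => tendsto_stirlingRemainder_nat (N + 1) (by linarith)) hx⟩
  rw [stirlingRemainder_sub_add_one _ (by linarith), abs_neg, abs_div]
  refine (div_le_self (abs_nonneg _) ?_).trans (hC y (by linarith))
  refine le_trans ?_ (le_abs_self _)
  linarith [(Nat.cast_nonneg (N + 1) : (0 : ℝ) ≤ (N + 1 : ℕ))]

lemma exists_abs_stirlingRemainder_le (N : ℕ) :
    ∃ C, ∀ x : ℝ, 1 ≤ x → |stirlingRemainder N x| ≤ C * (1 / x ^ (2 * N + 1)) := by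
  obtain ⟨C, hC⟩ := exists_abs_stirlingRemainder_succ_le N
  have hC0 : 0 ≤ C := by simpa using (abs_nonneg _).trans (hC 1 le_rfl)
  set b : ℝ := (bernoulli (2 * N + 2) : ℝ) / ((2 * N + 2) * (2 * N + 1))
  refine ⟨C + |b|, fun x hx => ?_⟩
  have hsplit : stirlingRemainder N x = stirlingRemainder (N + 1) x + b * (1 / x ^ (2 * N + 1)) := by
    rw [stirlingRemainder, stirlingRemainder, stirlingR_succ]
    ring
  have hpow : 1 / x ^ (2 * N + 2) ≤ 1 / x ^ (2 * N + 1) := by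
    gcongr
    norm_num
  calc |stirlingRemainder N x| ≤ |stirlingRemainder (N + 1) x| + |b * (1 / x ^ (2 * N + 1))| := by
        rw [hsplit]; exact abs_add_le _ _
    _ ≤ C * (1 / x ^ (2 * N + 1)) + |b| * (1 / x ^ (2 * N + 1)) := by
        rw [abs_mul, abs_of_nonneg (by positivity : 0 ≤ 1 / x ^ (2 * N + 1))]
        exact add_le_add_left ((hC x hx).trans (mul_le_mul_of_nonneg_left hpow hC0)) _
    _ = _ := by ring

/-- **Stirling's series**: for every `N`, the remainder `ln Γ(x) − P(x) − R_N(x)` is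
`O(x^{-(2N+1)})` as `x → ∞`; in particular it tends to `0`. -/
theorem stirling_series (N : ℕ) :
    ((fun x : ℝ => Real.log (Real.Gamma x) - stirlingP x - stirlingR N x) =O[atTop]
      fun x : ℝ => x ^ (-(2 * (N : ℤ) + 1))) ∧
    Tendsto (fun x : ℝ => Real.log (Real.Gamma x) - stirlingP x - stirlingR N x)
      atTop (𝓝 0) := by
  have hpow (x : ℝ) : x ^ (-(2 * (N : ℤ) + 1)) = 1 / x ^ (2 * N + 1) := by
    rw [zpow_neg, one_div]
    norm_cast
  simp only [hpow]
  have hO : (fun x : ℝ => Real.log (Real.Gamma x) - stirlingP x - stirlingR N x) =O[atTop]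
      fun x : ℝ => 1 / x ^ (2 * N + 1) := by
    obtain ⟨C, hC⟩ := exists_abs_stirlingRemainder_le N
    refine IsBigO.of_bound C ?_
    filter_upwards [eventually_ge_atTop 1] with x hx
    rw [Real.norm_of_nonneg (by positivity : 0 ≤ 1 / x ^ (2 * N + 1))]
    exact hC x hx
  exact ⟨hO, hO.trans_tendsto (tendsto_one_div_pow_atTop (by omega))⟩
end

section
/- (Namias's functional equation) Define F(x) = Γ(x) / exp(P(x)) for x > 1/2, where P(x) = x·ln x − x − (1/2)·ln x + (1/2)·ln(2π). Then for all real x > 1/2, F(2x) / (F(x) · F(x − 1/2)) = √e · (1 − 1/(2x))^x, where (1 − 1/(2x))^x = exp(x · ln(1 − 1/(2x))). -/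
open Real

/-- `F x = Γ(x) / exp (P x)`. -/
noncomputable def namiasF (x : ℝ) : ℝ := Real.Gamma x / Real.exp (stirlingP x)

/-- Legendre's duplication formula, solved for `Γ(2x)` and written with `Γ(x − 1/2)`. -/
theorem Gamma_two_mul_eq_exp_mul {x : ℝ} (hx : 1 / 2 < x) :
    Real.Gamma (2 * x) =
      Real.exp (Real.log (x - 1 / 2) - (1 - 2 * x) * Real.log 2 - (1 / 2) * Real.log π) *
        (Real.Gamma x * Real.Gamma (x - 1 / 2)) := by
  have hy : 0 < x - 1 / 2 := by linarith
  have hdup := Real.Gamma_mul_Gamma_add_half x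
  rw [show x + 1 / 2 = (x - 1 / 2) + 1 by ring, Real.Gamma_add_one hy.ne',
    Real.rpow_def_of_pos two_pos, Real.sqrt_eq_rpow, Real.rpow_def_of_pos pi_pos] at hdup
  rw [Real.exp_sub, Real.exp_sub, Real.exp_log hy, mul_comm (1 - 2 * x), mul_comm (1 / 2)]
  field_simp at hdup ⊢
  linarith

/-- The elementary part of the functional equation. -/
theorem stirlingP_add_stirlingP_sub_half {x : ℝ} (hx : 1 / 2 < x) :
    Real.log (x - 1 / 2) - (1 - 2 * x) * Real.log 2 - (1 / 2) * Real.log π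
        + stirlingP x + stirlingP (x - 1 / 2) - stirlingP (2 * x) =
      1 / 2 + x * Real.log (1 - 1 / (2 * x)) := by
  have hx0 : 0 < x := by linarith
  have hy : 0 < x - 1 / 2 := by linarith
  rw [show 1 - 1 / (2 * x) = (x - 1 / 2) / x by field_simp, Real.log_div hy.ne' hx0.ne']
  simp only [stirlingP]
  rw [Real.log_mul two_ne_zero hx0.ne', Real.log_mul two_ne_zero pi_ne_zero]
  ring

/-- **Namias's functional equation**: for `x > 1/2`,
`F(2x) / (F(x) F(x − 1/2)) = √e · (1 − 1/(2x))^x`. -/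
theorem namias_functional_equation (x : ℝ) (hx : 1 / 2 < x) :
    namiasF (2 * x) / (namiasF x * namiasF (x - 1 / 2)) =
      Real.sqrt (Real.exp 1) * Real.exp (x * Real.log (1 - 1 / (2 * x))) := by
  have hGx : Real.Gamma x ≠ 0 := (Real.Gamma_pos_of_pos (by linarith)).ne'
  have hGy : Real.Gamma (x - 1 / 2) ≠ 0 := (Real.Gamma_pos_of_pos (by linarith)).ne'
  rw [← Real.exp_half, ← Real.exp_add, ← stirlingP_add_stirlingP_sub_half hx, Real.exp_sub,
    Real.exp_add, Real.exp_add]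
  simp only [namiasF]
  rw [Gamma_two_mul_eq_exp_mul hx]
  generalize Real.Gamma (x - 1 / 2) = g at hGy ⊢
  field_simp
end
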